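/- Let G be a unicyclic graph whose unique cycle is the odd cycle C_{2n+1} = (x_1,…,x_{2n+1}) (n ≥ 1), let I = I(G) be its edge ideal, c = x_1⋯x_{2n+1}. For s ≥ 2n+2 let 𝒢_{s−(n+1)} be the set of minimal monomial generators of I^{s−(n+1)} that are not a multiple of any minimal monomial generator of the ideal I^{s−2(n+1)}·(c). Then for every s ≥ 2n+2, the symbolic defects satisfy the recursion sdefect(I, s) = |𝒢_{s−(n+1)}| + sdefect(I, s−(n+1)). -/

import Mathlib

open MvPolynomial

noncomputable section

/-- The edge ideal of a simple graph: `I(G) = ⟨X_u · X_v : {u,v} ∈ E(G)⟩`. -/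
def edgeIdeal (𝕜 : Type) [Field 𝕜] {V : Type} (G : SimpleGraph V) :
    Ideal (MvPolynomial V 𝕜) :=
  Ideal.span {p | ∃ u v : V, G.Adj u v ∧ p = X u * X v}

/-- `G` is a unicyclic graph (connected with exactly one cycle, equivalently connected with as
many edges as vertices) whose unique cycle is the odd cycle `C_{2n+1}` on the vertices `x j`. -/
structure IsUnicyclicOddCycle {V : Type} [Fintype V] (G : SimpleGraph V) (n : ℕ)
    (x : ZMod (2 * n + 1) → V) : Prop where
  connected : G.Connected
  edge_count : G.edgeSet.ncard = Fintype.card V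
  inj : Function.Injective x
  adj_iff : ∀ i j : ZMod (2 * n + 1), G.Adj (x i) (x j) ↔ (j = i + 1 ∨ i = j + 1)

/-- `f` is a minimal monomial generator of the monomial ideal `J`: it is a monic monomial
belonging to `J` such that no monic monomial of `J` properly divides it. -/
def IsMinMonomialGen {𝕜 : Type} [Field 𝕜] {V : Type} (J : Ideal (MvPolynomial V 𝕜))
    (f : MvPolynomial V 𝕜) : Prop :=
  (∃ m : V →₀ ℕ, f = monomial m 1) ∧ f ∈ J ∧
    ∀ g : MvPolynomial V 𝕜, (∃ m : V →₀ ℕ, g = monomial m 1) → g ∈ J → g ∣ f → g = f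

def localizationComap {R : Type} [CommRing R] (p : Ideal R) (hp : p.IsPrime) (J : Ideal R) :
    Ideal R :=
  letI := hp
  Ideal.comap (algebraMap R (Localization p.primeCompl))
    (Ideal.map (algebraMap R (Localization p.primeCompl)) J)

/-- The `s`-th symbolic power `I^{(s)} = ⋂_{p ∈ Ass(R/I)} (I^s R_p ∩ R)`. -/
def symbolicPower {R : Type} [CommRing R] (I : Ideal R) (s : ℕ) : Ideal R :=
  sInf {J : Ideal R | ∃ (p : Ideal R) (hp : p.IsPrime),
    p ∈ associatedPrimes R (R ⧸ I) ∧ J = localizationComap p hp (I ^ s)}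

/-- The `s`-th symbolic defect of `I`: the minimal number of generators of the module
`I^{(s)}/I^s`, i.e. the least `m` such that `I^{(s)} = I^s + (f_1, …, f_m)` for some
`f_1, …, f_m ∈ I^{(s)}`. -/
def sdefect {R : Type} [CommRing R] (I : Ideal R) (s : ℕ) : ℕ :=
  sInf {m : ℕ | ∃ S : Finset R, S.card = m ∧ (↑S : Set R) ⊆ (symbolicPower I s : Set R) ∧
    I ^ s ⊔ Ideal.span (↑S : Set R) = symbolicPower I s}

/-- vertex covers -/
def IsCov {V : Type} (G : SimpleGraph V) (W : Finset V) : Prop :=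
  ∀ u v, G.Adj u v → u ∈ W ∨ v ∈ W

/-- weight of an exponent vector on a set of vertices -/
def wt {V : Type} (W : Finset V) (m : V →₀ ℕ) : ℕ := ∑ v ∈ W, m v

/-- exponents of the monomials of the symbolic power -/
def AA {V : Type} (G : SimpleGraph V) (s : ℕ) (m : V →₀ ℕ) : Prop :=
  ∀ W : Finset V, IsCov G W → s ≤ wt W m

/-- exponent of an edge -/
def ee {V : Type} (u v : V) : V →₀ ℕ := Finsupp.single u 1 + Finsupp.single v 1

/-- exponents of the monomials of the ordinary power -/
def BB {V : Type} (G : SimpleGraph V) : ℕ → (V →₀ ℕ) → Prop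
  | 0, _ => True
  | s + 1, m => ∃ u v, G.Adj u v ∧ ∃ m', m = m' + ee u v ∧ BB G s m'

section comb
variable {V : Type} {G : SimpleGraph V}

lemma wt_add (W : Finset V) (m m' : V →₀ ℕ) : wt W (m + m') = wt W m + wt W m' := by
  simp [wt, Finset.sum_add_distrib]

lemma wt_single [DecidableEq V] (W : Finset V) (v : V) :
    wt W (Finsupp.single v 1) = if v ∈ W then 1 else 0 := by
  simp [wt, Finsupp.single_apply]

lemma wt_ee [DecidableEq V] (W : Finset V) (u v : V) :
    wt W (ee u v) = (if u ∈ W then 1 else 0) + (if v ∈ W then 1 else 0) := by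
  simp [ee, wt_add, wt_single]

lemma wt_mono {W : Finset V} {m m' : V →₀ ℕ} (h : m ≤ m') : wt W m ≤ wt W m' :=
  Finset.sum_le_sum fun v _ => h v

lemma AA_mono {s : ℕ} {m m' : V →₀ ℕ} (h : m ≤ m') (hm : AA G s m) : AA G s m' :=
  fun W hW => (hm W hW).trans (wt_mono h)

lemma BB_mono {s : ℕ} {m m' : V →₀ ℕ} (h : m ≤ m') (hm : BB G s m) : BB G s m' := by
  induction s generalizing m m' with
  | zero => trivial
  | succ s ih =>
    obtain ⟨u, v, huv, m1, rfl, hm1⟩ := hm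
    obtain ⟨k, rfl⟩ := exists_add_of_le h
    exact ⟨u, v, huv, m1 + k, by abel, ih (le_self_add) hm1⟩

lemma BB_add {s t : ℕ} {m m' : V →₀ ℕ} (h : BB G s m) (h' : BB G t m') :
    BB G (s + t) (m + m') := by
  induction s generalizing m with
  | zero => rw [zero_add]; exact BB_mono le_add_self h'
  | succ s ih =>
    obtain ⟨u, v, huv, m1, rfl, hm1⟩ := h
    rw [show s + 1 + t = (s + t) + 1 by omega]
    exact ⟨u, v, huv, m1 + m', by abel, ih hm1⟩

lemma BB_edge {u v : V} (h : G.Adj u v) : BB G 1 (ee u v) :=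
  ⟨u, v, h, 0, by simp, trivial⟩

lemma AA_add_edge {s : ℕ} {m : V →₀ ℕ} {u v : V} (h : G.Adj u v) (hm : AA G s m) :
    AA G (s + 1) (m + ee u v) := by
  classical
  intro W hW
  have := hm W hW
  rw [wt_add, wt_ee]
  rcases hW u v h with h | h <;> simp only [h, if_true] <;> omega

lemma BB_AA {s : ℕ} {m : V →₀ ℕ} (h : BB G s m) : AA G s m := by
  induction s generalizing m with
  | zero => intro W _; omega
  | succ s ih =>
    obtain ⟨u, v, huv, m1, rfl, hm1⟩ := h
    exact AA_add_edge huv (ih hm1)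

lemma wt_univ_ee [Fintype V] (u v : V) : wt Finset.univ (ee u v) = 2 := by
  classical
  simp [wt_ee]

/-- a matching of size `s` exactly covers some part -/
lemma BB_exact [Fintype V] {s : ℕ} {m : V →₀ ℕ} (h : BB G s m) :
    ∃ m1 r, m = m1 + r ∧ BB G s m1 ∧ wt Finset.univ m1 = 2 * s := by
  induction s generalizing m with
  | zero => exact ⟨0, m, by simp, trivial, by simp [wt]⟩
  | succ s ih =>
    obtain ⟨u, v, huv, m', rfl, hm'⟩ := h
    obtain ⟨m1, r, rfl, h1, h2⟩ := ih hm'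
    exact ⟨m1 + ee u v, r, by abel, ⟨u, v, huv, m1, rfl, h1⟩, by
      rw [wt_add, wt_univ_ee]; omega⟩

lemma BB_deg [Fintype V] {s : ℕ} {m : V →₀ ℕ} (h : BB G s m) : 2 * s ≤ wt Finset.univ m := by
  obtain ⟨m1, r, rfl, _, h2⟩ := BB_exact h
  rw [wt_add]; omega

lemma eq_of_le_of_wt [Fintype V] {m m' : V →₀ ℕ} (h : m ≤ m')
    (h' : wt Finset.univ m' ≤ wt Finset.univ m) : m = m' := by
  obtain ⟨k, rfl⟩ := exists_add_of_le h
  rw [wt_add] at h'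
  have h0 : wt Finset.univ k = 0 := by omega
  have : k = 0 := by
    ext v
    have := (Finset.sum_eq_zero_iff.mp h0) v (Finset.mem_univ v)
    simpa using this
  simp [this]

/-- in a perfect matching every vertex is matched -/
lemma BB_perfect [Fintype V] {s : ℕ} {m : V →₀ ℕ} (h : BB G (s + 1) m)
    (hd : wt Finset.univ m = 2 * (s + 1)) {y : V} (hy : m y ≠ 0) :
    ∃ w m', G.Adj y w ∧ m = m' + ee y w ∧ BB G s m' := by
  classical
  induction s generalizing m with
  | zero =>
    obtain ⟨u, v, huv, m', rfl, hm'⟩ := h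
    rw [wt_add, wt_univ_ee] at hd
    have h0 : 0 = m' := eq_of_le_of_wt (zero_le) (by omega)
    subst h0
    simp only [ee, zero_add, Finsupp.add_apply, Finsupp.single_apply] at hy
    by_cases h1 : u = y
    · subst h1; exact ⟨v, 0, huv, rfl, trivial⟩
    · by_cases h2 : v = y
      · subst h2; exact ⟨u, 0, huv.symm, by simp [ee, add_comm], trivial⟩
      · simp [h1, h2] at hy
  | succ s ih =>
    obtain ⟨u, v, huv, m', rfl, hm'⟩ := h
    by_cases h1 : u = y
    · subst h1; exact ⟨v, m', huv, rfl, hm'⟩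
    by_cases h2 : v = y
    · subst h2; exact ⟨u, m', huv.symm, by simp [ee, add_comm], hm'⟩
    rw [wt_add, wt_univ_ee] at hd
    have hy' : m' y ≠ 0 := by
      simpa [ee, Finsupp.single_apply, h1, h2] using hy
    obtain ⟨w, m'', hw, rfl, hm''⟩ := ih hm' (by omega) hy'
    exact ⟨w, m'' + ee u v, hw, by abel, ⟨u, v, huv, m'', rfl, hm''⟩⟩

lemma ee_le_of {m : V →₀ ℕ} {y z : V} (hyz : y ≠ z) (hy : m y ≠ 0) (hz : m z ≠ 0) :
    ee y z ≤ m := by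
  classical
  intro v
  simp only [ee, Finsupp.add_apply, Finsupp.single_apply]
  by_cases h1 : y = v
  · by_cases h2 : z = v
    · exact absurd (h1.trans h2.symm) hyz
    · simp [h1, h2]; subst h1; omega
  · by_cases h2 : z = v
    · simp [h1, h2]; subst h2; omega
    · simp [h1, h2]

/-- replacing a cover by a cheaper one when `y` has no neighbour in the support off `W` -/
lemma cov_erase [Fintype V] [DecidableEq V] {W : Finset V} (hW : IsCov G W) {m : V →₀ ℕ} {y : V}
    (h : ∀ w, m w ≠ 0 → G.Adj y w → w ∈ W) :
    IsCov G (W.erase y ∪ Finset.univ.filter (fun v => m v = 0)) ∧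
    wt (W.erase y ∪ Finset.univ.filter (fun v => m v = 0)) m ≤ wt (W.erase y) m := by
  constructor
  · intro u v huv
    by_cases hu : m u = 0
    · left; simp [hu]
    by_cases hv : m v = 0
    · right; simp [hv]
    by_cases hyu : u = y
    · subst hyu
      right
      simp [h v hv huv, huv.ne']
    by_cases hyv : v = y
    · subst hyv
      left
      simp [h u hu huv.symm, huv.ne]
    rcases hW u v huv with h | h
    · left; simp [h, hyu]
    · right; simp [h, hyv]
  · unfold wt
    refine (Finset.sum_union_inter (s₁ := W.erase y)
      (s₂ := Finset.univ.filter (fun v => m v = 0)) (f := fun v => m v) |>.le.trans' le_self_add).trans ?_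
    have : ∑ v ∈ Finset.univ.filter (fun v => m v = 0), m v = 0 :=
      Finset.sum_eq_zero (by simp)
    omega

lemma wt_erase_le [DecidableEq V] {W : Finset V} {m : V →₀ ℕ} {y : V} :
    wt (W.erase y) m ≤ wt W m :=
  Finset.sum_le_sum_of_subset (Finset.erase_subset _ _)

/-- leaf step -/
lemma AA_leaf [Fintype V] {s : ℕ} {m : V →₀ ℕ} {y z : V} (hyz : G.Adj y z)
    (hu : ∀ w, (m + ee y z) w ≠ 0 → G.Adj y w → w = z) (h : AA G (s + 1) (m + ee y z)) :
    AA G s m := by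
  classical
  intro W hW
  by_cases hz : z ∈ W
  · obtain ⟨h1, h2⟩ := cov_erase (y := y) (m := m + ee y z) hW
      (fun w hw hyw => by rw [hu w hw hyw]; exact hz)
    have h3 := (h _ h1).trans h2
    rw [wt_add, wt_ee] at h3
    have h4 : wt (W.erase y) m ≤ wt W m := wt_erase_le
    simp [hz, hyz.ne'] at h3
    omega
  · have h1 := h W hW
    rw [wt_add, wt_ee] at h1
    simp only [hz, if_false] at h1
    split_ifs at h1 <;> omega

/-- isolated step -/
lemma AA_isol [Fintype V] {s : ℕ} {m : V →₀ ℕ} {y : V}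
    (hu : ∀ w, (m + Finsupp.single y 1 : V →₀ ℕ) w ≠ 0 → ¬ G.Adj y w)
    (h : AA G s (m + Finsupp.single y 1)) : AA G s m := by
  classical
  intro W hW
  obtain ⟨h1, h2⟩ := cov_erase (y := y) (m := m + Finsupp.single y 1) hW
      (fun w hw hyw => absurd hyw (hu w hw))
  have h3 := (h _ h1).trans h2
  rw [wt_add, wt_single] at h3
  have h4 : wt (W.erase y) m ≤ wt W m := wt_erase_le
  simp at h3
  omega

end comb

section cyc

lemma two_ne_zero_zmod {n : ℕ} (hn : 1 ≤ n) : (1 : ZMod (2 * n + 1)) + 1 ≠ 0 := by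
  intro h
  have h2 : ((2 : ℕ) : ZMod (2 * n + 1)) = 0 := by push_cast; rw [← h]; norm_num
  rw [ZMod.natCast_eq_zero_iff] at h2
  have := Nat.le_of_dvd (by norm_num) h2
  omega

/-- covers of the odd cycle -/
def CycCov {n : ℕ} (U : Finset (ZMod (2 * n + 1))) : Prop := ∀ j, j ∈ U ∨ j + 1 ∈ U

lemma CycCov_card {n : ℕ} {U : Finset (ZMod (2 * n + 1))} (h : CycCov U) : n + 1 ≤ U.card := by
  classical
  have h1 : (Finset.univ : Finset (ZMod (2 * n + 1))) ⊆ U ∪ U.image (fun j => j - 1) := by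
    intro j _
    rcases h j with h | h
    · simp [h]
    · simp only [Finset.mem_union, Finset.mem_image]
      right; exact ⟨j + 1, h, by ring⟩
  have h2 := (Finset.card_le_card h1).trans (Finset.card_union_le _ _)
  have h3 : (U.image (fun j => j - 1)).card ≤ U.card := Finset.card_image_le
  rw [Finset.card_univ, ZMod.card] at h2
  omega

lemma val_step {n : ℕ} (a j : ZMod (2 * n + 1)) :
    ((j + 1 - a).val = (j - a).val + 1 ∧ (j - a).val < 2 * n) ∨
      (j + 1 = a ∧ (j - a).val = 2 * n) := by
  have hlt : (j - a).val < 2 * n + 1 := ZMod.val_lt _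
  have h1 : j + 1 - a = (((j - a).val + 1 : ℕ) : ZMod (2 * n + 1)) := by
    push_cast; rw [ZMod.natCast_zmod_val]; ring
  by_cases h : (j - a).val < 2 * n
  · left
    refine ⟨?_, h⟩
    rw [h1, ZMod.val_natCast, Nat.mod_eq_of_lt (by omega)]
  · right
    have h2 : (j - a).val = 2 * n := by omega
    refine ⟨?_, h2⟩
    rw [h2, ZMod.natCast_self] at h1
    exact sub_eq_zero.mp h1

lemma val_zero {n : ℕ} (a j : ZMod (2 * n + 1)) : (j - a).val = 0 ↔ j = a := by
  rw [ZMod.val_eq_zero, sub_eq_zero]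

lemma cyc_inter {n : ℕ} (M : ZMod (2 * n + 1) → ℕ) (hM : ∀ j, 1 ≤ M j) (s : ℕ)
    (hmin : ∀ U : Finset (ZMod (2 * n + 1)), CycCov U → s ≤ ∑ j ∈ U, M j)
    (a : ZMod (2 * n + 1)) (W W' : Finset (ZMod (2 * n + 1))) (hW : CycCov W) (hW' : CycCov W')
    (h1 : a - 1 ∈ W) (h2 : a ∈ W) (h3 : a ∈ W') (h4 : a + 1 ∈ W')
    (hs : ∑ j ∈ W, M j = s) (hs' : ∑ j ∈ W', M j = s) (p : ZMod (2 * n + 1))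
    (hp : p ∈ W) (hp' : p ∈ W') : p = a := by
  classical
  by_contra hpa
  have hk : 1 ≤ (p - a).val := by
    rcases Nat.eq_zero_or_pos (p - a).val with h | h
    · exact absurd ((val_zero _ _).mp h) hpa
    · exact h
  set k := (p - a).val with hkdef
  have hpk : ∀ j : ZMod (2 * n + 1), (j - a).val = k → j = p := by
    intro j hj
    have := ZMod.val_injective _ (hj.trans hkdef)
    exact sub_left_injective this
  let U : Finset (ZMod (2 * n + 1)) := Finset.univ.filter fun j =>
    (1 ≤ (j - a).val ∧ (j - a).val ≤ k ∧ j ∈ W') ∨ (k < (j - a).val ∧ j ∈ W)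
  let U' : Finset (ZMod (2 * n + 1)) := Finset.univ.filter fun j =>
    (1 ≤ (j - a).val ∧ (j - a).val ≤ k ∧ j ∈ W) ∨ ((k < (j - a).val ∨ (j - a).val = 0) ∧ j ∈ W')
  have hkn : k < 2 * n + 1 := ZMod.val_lt _
  have hU : CycCov U := by
    intro j
    simp only [U, Finset.mem_filter, Finset.mem_univ, true_and]
    have hp1 := hpk j
    rcases val_step a j with ⟨h5, h6⟩ | ⟨h5, h6⟩
    · rw [h5]
      rcases Nat.eq_zero_or_pos (j - a).val with h0 | h0
      · rw [(val_zero a j).mp h0]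
        right; left; simp [h4]; omega
      · rcases lt_trichotomy (j - a).val k with h7 | h7 | h7
        · rcases hW' j with h | h
          · left; left; exact ⟨h0, h7.le, h⟩
          · right; left; exact ⟨by omega, h7, h⟩
        · left; left; exact ⟨h0, h7.le, by rw [hp1 h7]; exact hp'⟩
        · rcases hW j with h | h
          · left; right; exact ⟨h7, h⟩
          · right; right; exact ⟨by omega, h⟩
    · have hj : j = a - 1 := by rw [← h5]; ring
      left
      by_cases h7 : k = 2 * n
      · left
        have := hp1 (h6.trans h7.symm)
        exact ⟨by omega, by omega, this ▸ hp'⟩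
      · right; exact ⟨by omega, hj ▸ h1⟩
  have hU' : CycCov U' := by
    intro j
    simp only [U', Finset.mem_filter, Finset.mem_univ, true_and]
    have hp1 := hpk j
    rcases val_step a j with ⟨h5, h6⟩ | ⟨h5, h6⟩
    · rw [h5]
      rcases Nat.eq_zero_or_pos (j - a).val with h0 | h0
      · left; right; exact ⟨Or.inr h0, (val_zero a j).mp h0 ▸ h3⟩
      · rcases lt_trichotomy (j - a).val k with h7 | h7 | h7
        · rcases hW j with h | h
          · left; left; exact ⟨h0, h7.le, h⟩
          · right; left; exact ⟨by omega, h7, h⟩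
        · left; left; exact ⟨h0, h7.le, by rw [hp1 h7]; exact hp⟩
        · rcases hW' j with h | h
          · left; right; exact ⟨Or.inl h7, h⟩
          · right; right; exact ⟨by omega, h⟩
    · right; right
      rw [h5]; exact ⟨Or.inr (by simp), h3⟩
  have e1 := hmin U hU
  have e2 := hmin U' hU'
  have key : ∑ j ∈ U, M j + ∑ j ∈ U', M j + M a = ∑ j ∈ W, M j + ∑ j ∈ W', M j := by
    have hsub : ∀ T : Finset (ZMod (2 * n + 1)), ∑ j ∈ T, M j = ∑ j, if j ∈ T then M j else 0 := by
      intro T; simp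
    have ha : M a = ∑ j, if j = a then M j else 0 := by simp
    rw [hsub U, hsub U', hsub W, hsub W', ha, ← Finset.sum_add_distrib, ← Finset.sum_add_distrib,
      ← Finset.sum_add_distrib]
    refine Finset.sum_congr rfl fun j _ => ?_
    simp only [U, U', Finset.mem_filter, Finset.mem_univ, true_and]
    rcases Nat.eq_zero_or_pos (j - a).val with h0 | h0
    · have := (val_zero a j).mp h0
      subst this
      simp [h2, h3]
    · have hja : j ≠ a := fun h => by rw [(val_zero a j).mpr h] at h0; omega
      have h0' : (j - a).val ≠ 0 := by omega
      have h0'' : 1 ≤ (j - a).val := h0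
      by_cases h7 : (j - a).val ≤ k
      · have h8 : ¬ k < (j - a).val := by omega
        simp only [h0'', h7, h8, h0', hja, if_false, true_and, false_and, or_false]
        omega
      · have h8 : k < (j - a).val := by omega
        simp only [h0'', h7, h8, hja, if_false, true_and, false_and, and_false, false_or,
          true_or]
        omega
  have := hM a
  omega

lemma cyc_lemma {n : ℕ} (M : ZMod (2 * n + 1) → ℕ) (hM : ∀ j, 1 ≤ M j) (s : ℕ)
    (hmin : ∀ U : Finset (ZMod (2 * n + 1)), CycCov U → s ≤ ∑ j ∈ U, M j)
    (ht : ∀ i, ∃ U : Finset (ZMod (2 * n + 1)), CycCov U ∧ i ∈ U ∧ i + 1 ∈ U ∧ ∑ j ∈ U, M j = s)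
    (a : ZMod (2 * n + 1)) : ∑ j, M j + M a = 2 * s := by
  classical
  obtain ⟨W, hW, h1, h2, hs⟩ := ht (a - 1)
  obtain ⟨W', hW', h3, h4, hs'⟩ := ht a
  rw [sub_add_cancel] at h2
  have hinter : W ∩ W' = {a} := by
    ext p
    simp only [Finset.mem_inter, Finset.mem_singleton]
    constructor
    · rintro ⟨hp, hp'⟩
      exact cyc_inter M hM s hmin a W W' hW hW' h1 h2 h3 h4 hs hs' p hp hp'
    · rintro rfl; exact ⟨h2, h3⟩
  have hc := Finset.card_union_add_card_inter W W'
  rw [hinter, Finset.card_singleton] at hc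
  have c1 := CycCov_card hW
  have c2 := CycCov_card hW'
  have hun : W ∪ W' = Finset.univ := by
    apply Finset.eq_univ_of_card
    rw [ZMod.card]
    have := Finset.card_le_univ (W ∪ W')
    rw [ZMod.card] at this
    omega
  have := Finset.sum_union_inter (s₁ := W) (s₂ := W') (f := M)
  rw [hun, hinter, Finset.sum_singleton] at this
  omega

end cyc

section graph
variable {V : Type} [Fintype V] {G : SimpleGraph V} {n : ℕ} {x : ZMod (2 * n + 1) → V}

lemma exists_parent (hn : 1 ≤ n) (hx : IsUnicyclicOddCycle G n x) :
    ∃ (p : V → V) (d : V → ℕ), (∀ i, p (x i) = x (i + 1)) ∧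
      (∀ v, v ∉ Set.range x → d (p v) < d v) ∧
      ∀ u v, G.Adj u v → v = p u ∨ u = p v := by
  classical
  have hpar : ∀ v, v ∉ Set.range x → ∃ w, G.Adj v w ∧ G.dist w (x 0) < G.dist v (x 0) := by
    intro v hv
    obtain ⟨w, hw⟩ := hx.connected.exists_walk_length_eq_dist v (x 0)
    cases w with
    | nil => exact absurd ⟨0, rfl⟩ hv
    | cons h q =>
      refine ⟨_, h, ?_⟩
      rw [← hw, SimpleGraph.Walk.length_cons]
      have := SimpleGraph.dist_le q
      omega
  choose! q hq1 hq2 using hpar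
  let p : V → V := fun v => if h : v ∈ Set.range x then x (h.choose + 1) else q v
  have hpx : ∀ i, p (x i) = x (i + 1) := by
    intro i
    have h : x i ∈ Set.range x := ⟨i, rfl⟩
    simp only [p, dif_pos h]
    rw [hx.inj h.choose_spec]
  have hpq : ∀ v, v ∉ Set.range x → p v = q v := fun v hv => by simp only [p, dif_neg hv]
  have hadj : ∀ v, G.Adj v (p v) := by
    intro v
    by_cases hv : v ∈ Set.range x
    · obtain ⟨i, rfl⟩ := hv
      rw [hpx, hx.adj_iff]; left; rfl
    · rw [hpq v hv]; exact hq1 v hv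
  have hd : ∀ v, v ∉ Set.range x → G.dist (p v) (x 0) < G.dist v (x 0) := fun v hv => by
    rw [hpq v hv]; exact hq2 v hv
  refine ⟨p, fun v => G.dist v (x 0), hpx, hd, ?_⟩
  let F : V → Sym2 V := fun v => s(v, p v)
  have hF : Function.Injective F := by
    intro v w hvw
    rcases Sym2.eq_iff.mp hvw with ⟨h, _⟩ | ⟨h1, h2⟩
    · exact h
    · exfalso
      by_cases hv : v ∈ Set.range x
      · obtain ⟨i, rfl⟩ := hv
        rw [hpx] at h2
        rw [← h2, hpx] at h1
        have := hx.inj h1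
        apply two_ne_zero_zmod hn
        rw [add_assoc] at this
        exact (left_eq_add.mp this)
      · by_cases hw : w ∈ Set.range x
        · obtain ⟨i, rfl⟩ := hw
          rw [hpx] at h1
          exact hv ⟨_, h1.symm⟩
        · have e1 := hd v hv
          have e2 := hd w hw
          rw [← h1] at e2; rw [h2] at e1
          omega
  have hsub : Set.range F ⊆ G.edgeSet := by
    rintro _ ⟨v, rfl⟩
    exact hadj v
  have heq : Set.range F = G.edgeSet := by
    apply Set.eq_of_subset_of_ncard_le hsub
    rw [hx.edge_count, ← Set.image_univ, Set.ncard_image_of_injective _ hF, Set.ncard_univ,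
      Nat.card_eq_fintype_card]
  intro u v huv
  have : s(u, v) ∈ Set.range F := by rw [heq]; exact huv
  obtain ⟨w, hw⟩ := this
  rcases Sym2.eq_iff.mp hw with ⟨rfl, h⟩ | ⟨rfl, h⟩
  · left; exact h.symm
  · right; exact h.symm

lemma exists_leaf (hn : 1 ≤ n) (hx : IsUnicyclicOddCycle G n x) (S : Finset V)
    (hS : ∃ v ∈ S, v ∉ Set.range x) :
    ∃ y ∈ S, y ∉ Set.range x ∧ ∃ z, ∀ w ∈ S, G.Adj y w → w = z := by
  classical
  obtain ⟨p, d, hp, hd, hG⟩ := exists_parent hn hx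
  obtain ⟨v, hv, hv'⟩ := hS
  obtain ⟨y, hy, hmax⟩ := Finset.exists_max_image (S.filter (fun v => v ∉ Set.range x)) d
    ⟨v, Finset.mem_filter.mpr ⟨hv, hv'⟩⟩
  rw [Finset.mem_filter] at hy
  refine ⟨y, hy.1, hy.2, p y, fun w hw hyw => ?_⟩
  rcases hG y w hyw with h | h
  · exact h
  · exfalso
    by_cases hwx : w ∈ Set.range x
    · obtain ⟨i, rfl⟩ := hwx
      rw [hp] at h
      exact hy.2 ⟨_, h.symm⟩
    · have e1 := hmax w (Finset.mem_filter.mpr ⟨hw, hwx⟩)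
      have e2 := hd w hwx
      rw [← h] at e2
      omega

lemma zmod_induct {n : ℕ} {P : ZMod (2 * n + 1) → Prop} (i : ZMod (2 * n + 1)) (h0 : P i)
    (h : ∀ j, P j → P (j + 1)) (j : ZMod (2 * n + 1)) : P j := by
  have : ∀ k : ℕ, P (i + k) := by
    intro k
    induction k with
    | zero => simpa using h0
    | succ k ih => push_cast; rw [← add_assoc]; exact h _ ih
  have h2 := this (j - i).val
  rw [ZMod.natCast_zmod_val] at h2
  simpa using h2

lemma exists_leaf' (hn : 1 ≤ n) (hx : IsUnicyclicOddCycle G n x) (S : Finset V)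
    (hS : S.Nonempty) : (∀ v, v ∈ S ↔ v ∈ Set.range x) ∨
    ∃ y ∈ S, ∃ z, ∀ w ∈ S, G.Adj y w → w = z := by
  classical
  by_cases h : ∃ v ∈ S, v ∉ Set.range x
  · obtain ⟨y, hy, _, z, hz⟩ := exists_leaf hn hx S h
    exact Or.inr ⟨y, hy, z, hz⟩
  push Not at h
  by_cases h2 : ∃ i, x i ∉ S ∧ x (i + 1) ∈ S
  · obtain ⟨i, h3, h4⟩ := h2
    right
    refine ⟨_, h4, x (i + 1 + 1), fun w hw hyw => ?_⟩
    obtain ⟨j, rfl⟩ := h w hw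
    rw [hx.adj_iff] at hyw
    rcases hyw with rfl | h5
    · rfl
    · have := add_right_cancel h5
      subst this
      exact absurd hw h3
  · left
    push Not at h2
    intro v
    refine ⟨h v, ?_⟩
    rintro ⟨j, rfl⟩
    by_contra hj
    have hall := zmod_induct (P := fun i => x i ∉ S) j hj h2
    obtain ⟨v, hv⟩ := hS
    obtain ⟨k, rfl⟩ := h v hv
    exact hall k hv

end graph

/-- exponent of the product of the cycle variables -/
def cc {V : Type} {n : ℕ} (x : ZMod (2 * n + 1) → V) : V →₀ ℕ :=
  ∑ j : ZMod (2 * n + 1), Finsupp.single (x j) 1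

set_option linter.unusedSectionVars false
set_option linter.unusedVariables false
section main
variable {V : Type} [Fintype V] {G : SimpleGraph V} {n : ℕ} {x : ZMod (2 * n + 1) → V}

lemma cc_apply (hx : Function.Injective x) (j : ZMod (2 * n + 1)) : cc x (x j) = 1 := by
  classical
  simp [cc, Finsupp.finsetSum_apply, Finsupp.single_apply, hx.eq_iff]

lemma cc_apply_not {v : V} (hv : v ∉ Set.range x) : cc x v = 0 := by
  classical
  simp only [cc, Finsupp.finsetSum_apply, Finsupp.single_apply]
  refine Finset.sum_eq_zero fun j _ => ?_
  rw [if_neg]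
  rintro rfl
  exact hv ⟨j, rfl⟩

lemma wt_cc [DecidableEq V] (W : Finset V) :
    wt W (cc x) = (Finset.univ.filter (fun j => x j ∈ W)).card := by
  have : wt W (cc x) = ∑ j, wt W (Finsupp.single (x j) 1) := by
    simp only [wt, cc, Finsupp.finsetSum_apply]
    exact Finset.sum_comm
  rw [this]
  simp [wt_single]

lemma wt_univ_cc : wt Finset.univ (cc x) = 2 * n + 1 := by
  classical
  rw [wt_cc]
  simp [ZMod.card]

lemma cov_cyc (hx : IsUnicyclicOddCycle G n x) [DecidableEq V] {W : Finset V} (hW : IsCov G W) :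
    CycCov (Finset.univ.filter (fun j => x j ∈ W)) := by
  intro j
  simp only [Finset.mem_filter, Finset.mem_univ, true_and]
  exact hW _ _ ((hx.adj_iff _ _).mpr (Or.inl rfl))

lemma AA_cc (hx : IsUnicyclicOddCycle G n x) : AA G (n + 1) (cc x) := by
  classical
  intro W hW
  rw [wt_cc]
  exact CycCov_card (cov_cyc hx hW)

lemma AA_add {s t : ℕ} {m m' : V →₀ ℕ} (h : AA G s m) (h' : AA G t m') :
    AA G (s + t) (m + m') := by
  intro W hW
  rw [wt_add]
  exact add_le_add (h W hW) (h' W hW)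

lemma AA_nsmul {s : ℕ} {m : V →₀ ℕ} (h : AA G s m) (k : ℕ) : AA G (k * s) (k • m) := by
  induction k with
  | zero => intro W _; simp
  | succ k ih => rw [succ_nsmul, Nat.succ_mul]; exact AA_add ih h

/-- the cycle case -/
lemma cycle_case (hn : 1 ≤ n) (hx : IsUnicyclicOddCycle G n x) (s : ℕ) (m : V →₀ ℕ)
    (hm : AA G (s + 1) m) (hsupp : ∀ v, m v ≠ 0 ↔ v ∈ Set.range x) :
    (∃ i m1, m = m1 + ee (x i) (x (i + 1)) ∧ AA G s m1) ∨
    ∃ K, m = (K + 1) • cc x ∧ s + 1 = (K + 1) * (n + 1) := by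
  classical
  by_cases hex : ∃ i m1, m = m1 + ee (x i) (x (i + 1)) ∧ AA G s m1
  · exact Or.inl hex
  right
  push Not at hex
  have hM : ∀ j, 1 ≤ m (x j) := fun j => Nat.one_le_iff_ne_zero.mpr ((hsupp _).mpr ⟨j, rfl⟩)
  have hmin : ∀ U : Finset (ZMod (2 * n + 1)), CycCov U → s + 1 ≤ ∑ j ∈ U, m (x j) := by
    intro U hU
    have hcov : IsCov G (U.image x ∪ Finset.univ.filter (fun v => v ∉ Set.range x)) := by
      intro u v huv
      by_cases hu : u ∈ Set.range x
      · by_cases hv : v ∈ Set.range x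
        · obtain ⟨i, rfl⟩ := hu
          obtain ⟨j, rfl⟩ := hv
          simp only [Finset.mem_union, Finset.mem_image, hx.inj.eq_iff, exists_eq_right]
          rcases (hx.adj_iff _ _).mp huv with rfl | rfl
          · rcases hU i with h | h <;> simp [h]
          · rcases hU j with h | h <;> simp [h]
        · right; exact Finset.mem_union_right _ (Finset.mem_filter.mpr ⟨Finset.mem_univ _, hv⟩)
      · left; exact Finset.mem_union_right _ (Finset.mem_filter.mpr ⟨Finset.mem_univ _, hu⟩)
    have h1 := hm _ hcov
    have h2 : wt (U.image x ∪ Finset.univ.filter (fun v => v ∉ Set.range x)) m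
        = ∑ j ∈ U, m (x j) := by
      unfold wt
      rw [Finset.sum_union, Finset.sum_image (fun a _ b _ h => hx.inj h)]
      · have : ∑ v ∈ Finset.univ.filter (fun v => v ∉ Set.range x), m v = 0 := by
          refine Finset.sum_eq_zero fun v hv => ?_
          by_contra h
          exact (Finset.mem_filter.mp hv).2 ((hsupp v).mp h)
        omega
      · rw [Finset.disjoint_left]
        intro v hv hv'
        obtain ⟨j, _, rfl⟩ := Finset.mem_image.mp hv
        exact (Finset.mem_filter.mp hv').2 ⟨j, rfl⟩
    omega
  have hwt : ∀ W : Finset V, wt W m = ∑ j ∈ Finset.univ.filter (fun j => x j ∈ W), m (x j) := by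
    intro W
    unfold wt
    symm
    refine Finset.sum_of_injOn x (fun a _ b _ h => hx.inj h) ?_ ?_ (fun _ _ => rfl)
    · intro j hj
      exact (Finset.mem_filter.mp hj).2
    · intro v hv hv'
      by_contra h
      obtain ⟨j, rfl⟩ := (hsupp v).mp h
      exact hv' ⟨j, by simpa using hv, rfl⟩
  have ht : ∀ i, ∃ U : Finset (ZMod (2 * n + 1)), CycCov U ∧ i ∈ U ∧ i + 1 ∈ U ∧
      ∑ j ∈ U, m (x j) = s + 1 := by
    intro i
    have hadj : G.Adj (x i) (x (i + 1)) := (hx.adj_iff _ _).mpr (Or.inl rfl)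
    have hle : ee (x i) (x (i + 1)) ≤ m :=
      ee_le_of hadj.ne ((hsupp _).mpr ⟨_, rfl⟩) ((hsupp _).mpr ⟨_, rfl⟩)
    obtain ⟨m1, hm1⟩ := exists_add_of_le hle
    rw [add_comm] at hm1
    have := hex i m1 hm1
    unfold AA at this
    push Not at this
    obtain ⟨W, hW, hlt⟩ := this
    have h1 := hm W hW
    have h2 : wt W m = wt W m1 + wt W (ee (x i) (x (i + 1))) := by rw [← wt_add, ← hm1]
    rw [wt_ee] at h2
    refine ⟨_, cov_cyc hx hW, ?_, ?_, ?_⟩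
    · simp only [Finset.mem_filter, Finset.mem_univ, true_and]
      by_contra h
      simp only [h, if_false] at h2
      split_ifs at h2 <;> omega
    · simp only [Finset.mem_filter, Finset.mem_univ, true_and]
      by_contra h
      simp only [h, if_false] at h2
      split_ifs at h2 <;> omega
    · rw [← hwt]
      split_ifs at h2 <;> omega
  have key := cyc_lemma (fun j => m (x j)) hM (s + 1) hmin ht
  have hconst : ∀ j, m (x j) = m (x 0) := fun j => by
    have h1 := key j
    have h2 := key 0
    omega
  obtain ⟨K, hK⟩ := Nat.exists_eq_add_of_le' (hM 0)
  refine ⟨K, ?_, ?_⟩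
  · ext v
    by_cases hv : v ∈ Set.range x
    · obtain ⟨j, rfl⟩ := hv
      simp [cc_apply hx.inj, hconst j, hK]
    · simp only [Finsupp.smul_apply, cc_apply_not hv, smul_zero]
      by_contra h
      exact hv ((hsupp v).mp h)
  · have h2 := key 0
    rw [Finset.sum_congr rfl (fun j _ => hconst j)] at h2
    simp only [Finset.sum_const, Finset.card_univ, ZMod.card, smul_eq_mul, hK] at h2
    nlinarith

theorem T1 (hn : 1 ≤ n) (hx : IsUnicyclicOddCycle G n x) (s : ℕ) (m : V →₀ ℕ)
    (hm : AA G s m) :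
    BB G s m ∨ ∃ m' s', m = m' + cc x ∧ s = s' + (n + 1) ∧ AA G s' m' := by
  classical
  induction hd : wt Finset.univ m using Nat.strong_induction_on generalizing m s with
  | _ D ih =>
  subst hd
  cases s with
  | zero => left; trivial
  | succ s =>
  have hrem : ∀ u v m1, G.Adj u v → m = m1 + ee u v → AA G s m1 →
      BB G (s + 1) m ∨ ∃ m' s', m = m' + cc x ∧ s + 1 = s' + (n + 1) ∧ AA G s' m' := by
    rintro u v m1 huv rfl h1
    rcases ih _ (by rw [wt_add, wt_univ_ee]; omega) s m1 h1 rfl with h | ⟨m', s', rfl, rfl, h'⟩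
    · left; exact ⟨u, v, huv, m1, rfl, h⟩
    · right; exact ⟨m' + ee u v, s' + 1, by abel, by omega, AA_add_edge huv h'⟩
  have hne : m.support.Nonempty := by
    rw [Finset.nonempty_iff_ne_empty]
    intro h
    rw [Finsupp.support_eq_empty] at h
    subst h
    have := hm Finset.univ (fun u _ _ => Or.inl (Finset.mem_univ u))
    simp [wt] at this
  rcases exists_leaf' hn hx m.support hne with h | ⟨y, hy, z, hz⟩
  · rcases cycle_case hn hx s m hm (fun v => by rw [← h v, Finsupp.mem_support_iff]) with
      ⟨i, m1, hm1, h1⟩ | ⟨K, rfl, h2⟩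
    · exact hrem _ _ m1 ((hx.adj_iff _ _).mpr (Or.inl rfl)) hm1 h1
    · right
      exact ⟨K • cc x, K * (n + 1), succ_nsmul _ _, by rw [h2]; ring, AA_nsmul (AA_cc hx) K⟩
  · simp only [Finsupp.mem_support_iff] at hy hz
    by_cases hyz : G.Adj y z ∧ m z ≠ 0
    · obtain ⟨m1, hm1⟩ := exists_add_of_le (ee_le_of hyz.1.ne hy hyz.2)
      rw [add_comm] at hm1
      refine hrem y z m1 hyz.1 hm1 ?_
      subst hm1
      exact AA_leaf hyz.1 hz hm
    · have hle : Finsupp.single y 1 ≤ m := by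
        rw [Finsupp.single_le_iff]; omega
      obtain ⟨m1, hm1⟩ := exists_add_of_le hle
      rw [add_comm] at hm1
      subst hm1
      have h1 : AA G (s + 1) m1 := by
        refine AA_isol (fun w hw hyw => hyz ?_) hm
        have := hz w hw hyw
        subst this
        exact ⟨hyw, hw⟩
      rcases ih _ (by rw [wt_add, wt_single]; simp) _ m1 h1 rfl with h | ⟨m', s', rfl, h2, h'⟩
      · left; exact BB_mono le_self_add h
      · right; exact ⟨m' + Finsupp.single y 1, s', by abel, h2, AA_mono le_self_add h'⟩

/-- degree bound -/
theorem T2 (hn : 1 ≤ n) (hx : IsUnicyclicOddCycle G n x) (s : ℕ) (m : V →₀ ℕ)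
    (hm : AA G s m) : ∃ g ≤ m, AA G s g ∧ wt Finset.univ g ≤ 2 * s := by
  induction s using Nat.strong_induction_on generalizing m with
  | _ s ih =>
  rcases T1 hn hx s m hm with h | ⟨m', s', rfl, rfl, h'⟩
  · obtain ⟨m1, r, rfl, h1, h2⟩ := BB_exact h
    exact ⟨m1, le_self_add, BB_AA h1, h2.le⟩
  · obtain ⟨g, hg, h1, h2⟩ := ih s' (by omega) m' h'
    refine ⟨g + cc x, add_le_add_left hg _, AA_add h1 (AA_cc hx), ?_⟩
    rw [wt_add, wt_univ_cc]
    omega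

lemma sum_walk (hx : Function.Injective x) (i : ZMod (2 * n + 1)) :
    ∑ l ∈ Finset.range (2 * n + 1), Finsupp.single (x (i + l)) 1 = cc x := by
  classical
  unfold cc
  refine Finset.sum_nbij (fun l : ℕ => i + (l : ZMod (2 * n + 1))) (by simp) ?_ ?_ (by simp)
  · intro a ha b hb hab
    simp only [Finset.coe_range, Set.mem_Iio] at ha hb
    have := add_left_cancel hab
    rw [ZMod.natCast_eq_natCast_iff'] at this
    rwa [Nat.mod_eq_of_lt ha, Nat.mod_eq_of_lt hb] at this
  · intro j _
    refine ⟨(j - i).val, ?_, ?_⟩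
    · simpa using ZMod.val_lt (j - i)
    · simp

lemma BB_walk (hx : IsUnicyclicOddCycle G n x) (i : ZMod (2 * n + 1)) (k : ℕ) :
    BB G k (∑ l ∈ Finset.range (2 * k), Finsupp.single (x (i + l)) 1) := by
  induction k with
  | zero => trivial
  | succ k ih =>
    rw [show 2 * (k + 1) = 2 * k + 1 + 1 by ring, Finset.sum_range_succ, Finset.sum_range_succ,
      add_assoc]
    refine BB_add ih (BB_edge ((hx.adj_iff _ _).mpr (Or.inl ?_)))
    push_cast
    ring

lemma BB_cc_single (hx : IsUnicyclicOddCycle G n x) (i : ZMod (2 * n + 1)) :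
    BB G (n + 1) (Finsupp.single (x i) 1 + cc x) := by
  have := BB_walk hx i (n + 1)
  rw [show 2 * (n + 1) = 2 * n + 1 + 1 by ring, Finset.sum_range_succ, sum_walk hx.inj,
    ZMod.natCast_self, add_zero, add_comm (cc x)] at this
  exact this

lemma BB_ccs (hx : IsUnicyclicOddCycle G n x) (j : ℕ) (r : V →₀ ℕ)
    (hr : ∀ v, r v ≠ 0 → v ∈ Set.range x) (hj : j ≤ wt Finset.univ r) :
    BB G (j * (n + 1)) (r + j • cc x) := by
  classical
  induction j generalizing r with
  | zero => rw [zero_mul]; trivial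
  | succ j ih =>
    have : ∃ v, r v ≠ 0 := by
      by_contra h
      push Not at h
      simp [wt, h] at hj
    obtain ⟨v, hv⟩ := this
    obtain ⟨i, rfl⟩ := hr v hv
    have hle : Finsupp.single (x i) 1 ≤ r := by
      rw [Finsupp.single_le_iff]; omega
    obtain ⟨r1, rfl⟩ := exists_add_of_le hle
    have h1 := ih r1 (fun v hv => hr v (by simp [hv])) (by
      rw [wt_add, wt_single] at hj; simp at hj; omega)
    have := BB_add h1 (BB_cc_single hx i)
    rw [Nat.succ_mul, succ_nsmul]
    convert this using 1
    abel

lemma C_lemma (hn : 1 ≤ n) (hx : IsUnicyclicOddCycle G n x) (k j : ℕ) (h : V →₀ ℕ)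
    (hs : ∀ v, h v ≠ 0 → v ∈ Set.range x) (hA : AA G k h) (hd : 2 * k + j ≤ wt Finset.univ h) :
    BB G (k + j * (n + 1)) (h + j • cc x) := by
  induction k using Nat.strong_induction_on generalizing h j with
  | _ k ih =>
  rcases T1 hn hx k h hA with hB | ⟨m', s', rfl, rfl, h'⟩
  · obtain ⟨m1, r, rfl, h1, h2⟩ := BB_exact hB
    rw [add_assoc]
    refine BB_add h1 (BB_ccs hx j r (fun v hv => hs v (by simp [hv])) ?_)
    rw [wt_add] at hd; omega
  · have := ih s' (by omega) (j + 1) m' (fun v hv => hs v (by simp [hv])) h' (by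
      rw [wt_add, wt_univ_cc] at hd; omega)
    convert this using 1
    · ring
    · rw [succ_nsmul]; abel

theorem T3 (hn : 1 ≤ n) (hx : IsUnicyclicOddCycle G n x) (k : ℕ) (h : V →₀ ℕ)
    (hA : AA G k h) (hd : wt Finset.univ h = 2 * k + 1) (hB : BB G (k + n + 1) (h + cc x)) :
    BB G k h := by
  classical
  induction k generalizing h with
  | zero => trivial
  | succ k ih =>
  rcases T1 hn hx _ h hA with hB' | ⟨m', s', hm', -, -⟩
  · exact hB'
  have hcc : ∀ w, (h + cc x) w ≠ 0 → h w ≠ 0 := by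
    intro w hw hw'
    by_cases hwx : w ∈ Set.range x
    · obtain ⟨i, rfl⟩ := hwx
      rw [hm'] at hw'
      simp [cc_apply hx.inj] at hw'
    · simp [cc_apply_not hwx, hw'] at hw
  by_cases hs : ∃ v ∈ h.support, v ∉ Set.range x
  · obtain ⟨y, hy, hyx, z, hz⟩ := exists_leaf hn hx _ hs
    simp only [Finsupp.mem_support_iff] at hy hz
    rw [show k + 1 + n + 1 = (k + n + 1) + 1 by ring] at hB
    obtain ⟨w, f', hyw, hf, hf'⟩ := BB_perfect hB (by rw [wt_add, wt_univ_cc, hd]; ring)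
      (y := y) (by simp [hy])
    have hw : h w ≠ 0 := hcc w (by rw [hf]; simp [ee])
    have hwz := hz w hw hyw
    subst hwz
    obtain ⟨h1, hh1⟩ := exists_add_of_le (ee_le_of hyw.ne hy hw)
    rw [add_comm] at hh1
    subst hh1
    have hf2 : f' = h1 + cc x := by
      have : f' + ee y w = (h1 + cc x) + ee y w := by rw [← hf]; abel
      exact add_right_cancel this
    subst hf2
    refine ⟨y, w, hyw, h1, rfl, ih h1 (AA_leaf hyw hz hA) ?_ hf'⟩
    rw [wt_add, wt_univ_ee] at hd; omega
  · push Not at hs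
    have := C_lemma hn hx (k + 1) 0 h (fun v hv => hs v (by simpa using hv)) hA (by omega)
    simpa using this

end main

section alg
variable {V : Type} [Fintype V] {𝕜 : Type} [Field 𝕜] {G : SimpleGraph V}

lemma edgeIdeal_pow_eq (s : ℕ) : (edgeIdeal 𝕜 G) ^ s =
    Ideal.span ((fun m => monomial m (1 : 𝕜)) '' {m | BB G s m}) := by
  induction s with
  | zero =>
    rw [pow_zero, Ideal.one_eq_top, eq_comm, Ideal.eq_top_iff_one]
    exact Ideal.subset_span ⟨0, trivial, rfl⟩
  | succ s ih =>
    rw [pow_succ, ih, edgeIdeal, Ideal.span_mul_span']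
    apply le_antisymm
    · rw [Ideal.span_le]
      rintro _ ⟨_, ⟨m, hm, rfl⟩, _, ⟨u, v, huv, rfl⟩, rfl⟩
      refine Ideal.subset_span ⟨m + ee u v, ⟨u, v, huv, m, rfl, hm⟩, ?_⟩
      simp [ee, X, monomial_mul]
    · rw [Ideal.span_le]
      rintro _ ⟨_, ⟨u, v, huv, m, rfl, hm⟩, rfl⟩
      refine Ideal.subset_span ⟨monomial m 1, ⟨m, hm, rfl⟩, X u * X v, ⟨u, v, huv, rfl⟩, ?_⟩
      simp [ee, X, monomial_mul]

lemma mem_edgeIdeal_pow (s : ℕ) (f : MvPolynomial V 𝕜) :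
    f ∈ (edgeIdeal 𝕜 G) ^ s ↔ ∀ m ∈ f.support, BB G s m := by
  rw [edgeIdeal_pow_eq, mem_ideal_span_monomial_image]
  refine forall₂_congr fun m _ => ⟨?_, fun h => ⟨m, h, le_rfl⟩⟩
  rintro ⟨m', h, hle⟩
  exact BB_mono hle h

lemma monomial_mem_pow (s : ℕ) (m : V →₀ ℕ) :
    monomial m (1 : 𝕜) ∈ (edgeIdeal 𝕜 G) ^ s ↔ BB G s m := by
  classical
  rw [mem_edgeIdeal_pow, support_monomial]
  simp

/-- grading by the degree in the variables of `W` -/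
def phi (𝕜 : Type) [Field 𝕜] [DecidableEq V] (W : Finset V) :
    MvPolynomial V 𝕜 →ₐ[𝕜] Polynomial (MvPolynomial V 𝕜) :=
  aeval fun v => (if v ∈ W then Polynomial.X else 1) * Polynomial.C (X v)

lemma phi_monomial [DecidableEq V] (W : Finset V) (m : V →₀ ℕ) (a : 𝕜) :
    phi 𝕜 W (monomial m a) = Polynomial.monomial (wt W m) (monomial m a) := by
  rw [phi, aeval_monomial, Finsupp.prod_fintype _ _ (by simp)]
  simp only [mul_pow, Finset.prod_mul_distrib, ite_pow, one_pow]
  rw [Finset.prod_ite_mem, Finset.univ_inter, Finset.prod_pow_eq_pow_sum]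
  rw [← Polynomial.C_mul_X_pow_eq_monomial, monomial_eq, Finsupp.prod_fintype _ _ (by simp)]
  simp only [map_mul, map_prod, map_pow]
  rw [show algebraMap 𝕜 (Polynomial (MvPolynomial V 𝕜)) a = Polynomial.C (C a) from rfl]
  unfold wt
  ring

lemma coeff_phi [DecidableEq V] (W : Finset V) (f : MvPolynomial V 𝕜) (d : ℕ) (m : V →₀ ℕ) :
    coeff m ((phi 𝕜 W f).coeff d) = if wt W m = d then coeff m f else 0 := by
  induction f using MvPolynomial.induction_on' with
  | monomial m' a =>
    rw [phi_monomial, Polynomial.coeff_monomial]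
    by_cases h : m' = m
    · subst h
      split_ifs <;> simp
    · split_ifs <;> simp [coeff_monomial, h]
  | add p q hp hq =>
    rw [map_add, Polynomial.coeff_add, coeff_add, hp, hq, coeff_add]
    split_ifs <;> simp

lemma X_pow_dvd_phi [DecidableEq V] (W : Finset V) (f : MvPolynomial V 𝕜) (s : ℕ) :
    Polynomial.X ^ s ∣ phi 𝕜 W f ↔ ∀ m ∈ f.support, s ≤ wt W m := by
  rw [Polynomial.X_pow_dvd_iff]
  constructor
  · intro h m hm
    by_contra hlt
    have := congrArg (coeff m) (h (wt W m) (by omega))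
    rw [coeff_phi, if_pos rfl] at this
    exact (mem_support_iff.mp hm) (by simpa using this)
  · intro h d hd
    ext m
    rw [coeff_phi, coeff_zero]
    split_ifs with h1
    · by_contra h2
      have := h m (mem_support_iff.mpr h2)
      omega
    · rfl

/-- the prime of a vertex cover -/
def PW (𝕜 : Type) [Field 𝕜] [DecidableEq V] (W : Finset V) : Ideal (MvPolynomial V 𝕜) :=
  Ideal.comap (phi 𝕜 W) (Ideal.span {Polynomial.X})

lemma PW_prime [DecidableEq V] (W : Finset V) : (PW 𝕜 W).IsPrime := by
  have : (Ideal.span {(Polynomial.X : Polynomial (MvPolynomial V 𝕜))}).IsPrime :=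
    (Ideal.span_singleton_prime Polynomial.X_ne_zero).mpr Polynomial.prime_X
  exact Ideal.IsPrime.comap _

lemma mem_PW_dvd [DecidableEq V] (W : Finset V) (f : MvPolynomial V 𝕜) :
    f ∈ PW 𝕜 W ↔ Polynomial.X ∣ phi 𝕜 W f := by
  rw [PW, Ideal.mem_comap, Ideal.mem_span_singleton]

lemma mem_PW [DecidableEq V] (W : Finset V) (f : MvPolynomial V 𝕜) :
    f ∈ PW 𝕜 W ↔ ∀ m ∈ f.support, 1 ≤ wt W m := by
  rw [mem_PW_dvd, ← X_pow_dvd_phi, pow_one]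

/-- irredundant covers -/
def IsMinCov (G : SimpleGraph V) (W : Finset V) : Prop :=
  IsCov G W ∧ ∀ w ∈ W, ∃ v, v ∉ W ∧ G.Adj w v

lemma exists_minCov (W : Finset V) (hW : IsCov G W) : ∃ W' ⊆ W, IsMinCov G W' := by
  classical
  induction h : W.card using Nat.strong_induction_on generalizing W with
  | _ k ih =>
  subst h
  by_cases hmin : ∀ w ∈ W, ∃ v, v ∉ W ∧ G.Adj w v
  · exact ⟨W, subset_rfl, hW, hmin⟩
  push Not at hmin
  obtain ⟨w, hw, hw'⟩ := hmin
  have hcov : IsCov G (W.erase w) := by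
    intro u v huv
    by_cases hu : u = w
    · subst hu
      right
      refine Finset.mem_erase.mpr ⟨huv.ne', ?_⟩
      by_contra h
      exact hw' v h huv
    by_cases hv : v = w
    · subst hv
      left
      refine Finset.mem_erase.mpr ⟨huv.ne, ?_⟩
      by_contra h
      exact hw' u h huv.symm
    rcases hW u v huv with h | h
    · left; exact Finset.mem_erase.mpr ⟨hu, h⟩
    · right; exact Finset.mem_erase.mpr ⟨hv, h⟩
  obtain ⟨W', h1, h2⟩ := ih _ (Finset.card_erase_lt_of_mem hw) _ hcov rfl
  exact ⟨W', h1.trans (Finset.erase_subset _ _), h2⟩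

/-- exponent of the product of the variables outside `W` -/
def uu (W : Finset V) [DecidableEq V] : V →₀ ℕ := ∑ v ∈ Wᶜ, Finsupp.single v 1

lemma uu_apply [DecidableEq V] (W : Finset V) (v : V) : uu W v = if v ∈ W then 0 else 1 := by
  simp only [uu, Finsupp.finsetSum_apply, Finsupp.single_apply]
  simp

lemma wt_uu [DecidableEq V] (W : Finset V) (k : ℕ) : wt W (k • uu W) = 0 := by
  refine Finset.sum_eq_zero fun v hv => ?_
  simp [uu_apply, hv]

lemma BB_uu [DecidableEq V] {W : Finset V} (hW : IsMinCov G W) (k : ℕ) (m : V →₀ ℕ)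
    (hk : k ≤ wt W m) : BB G k (m + k • uu W) := by
  induction k generalizing m with
  | zero => trivial
  | succ k ih =>
    have : ∃ w ∈ W, m w ≠ 0 := by
      by_contra h
      push Not at h
      have : wt W m = 0 := Finset.sum_eq_zero h
      omega
    obtain ⟨w, hw, hmw⟩ := this
    obtain ⟨v, hv, hwv⟩ := hW.2 w hw
    have hle : Finsupp.single w 1 ≤ m := by rw [Finsupp.single_le_iff]; omega
    have hle' : Finsupp.single v 1 ≤ uu W := by
      rw [Finsupp.single_le_iff, uu_apply, if_neg hv]
    obtain ⟨m1, rfl⟩ := exists_add_of_le hle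
    rw [wt_add, wt_single, if_pos hw] at hk
    have h1 := BB_add (ih m1 (by omega)) (BB_edge hwv)
    refine BB_mono ?_ h1
    rw [succ_nsmul, ee]
    calc m1 + k • uu W + (Finsupp.single w 1 + Finsupp.single v 1)
        = Finsupp.single w 1 + m1 + (k • uu W + Finsupp.single v 1) := by abel
      _ ≤ _ := by gcongr

lemma PW_assoc [DecidableEq V] {W : Finset V} (hW : IsMinCov G W) :
    PW 𝕜 W ∈ associatedPrimes (MvPolynomial V 𝕜) (MvPolynomial V 𝕜 ⧸ edgeIdeal 𝕜 G) := by
  refine Submodule.isAssociatedPrime_iff.mpr ⟨PW_prime W,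
    Ideal.Quotient.mk _ (monomial (uu W) 1), ?_⟩
  ext f
  rw [Submodule.mem_colon_singleton, Submodule.mem_bot,
    show f • (Ideal.Quotient.mk (edgeIdeal 𝕜 G) (monomial (uu W) 1)) =
      Ideal.Quotient.mk (edgeIdeal 𝕜 G) (f * monomial (uu W) 1) from rfl,
    Ideal.Quotient.eq_zero_iff_mem]
  constructor
  · intro hf
    rw [f.as_sum, Finset.sum_mul]
    refine Ideal.sum_mem _ fun m hm => ?_
    have h1 := BB_uu hW 1 m ((mem_PW W f).mp hf m hm)
    rw [one_smul] at h1
    have h2 := (monomial_mem_pow (𝕜 := 𝕜) 1 _).mpr h1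
    rw [pow_one] at h2
    have h3 := Ideal.mul_mem_left _ (C (coeff m f)) h2
    rwa [C_mul_monomial, mul_one, ← mul_one (coeff m f), ← monomial_mul] at h3
  · intro hf
    have h1 : f * monomial (uu W) 1 ∈ PW 𝕜 W := by
      rw [mem_PW]
      rw [← pow_one (edgeIdeal 𝕜 G), mem_edgeIdeal_pow] at hf
      exact fun m hm => BB_AA (hf m hm) W hW.1
    rcases (PW_prime W).mem_or_mem h1 with h | h
    · exact h
    · exfalso
      rw [mem_PW] at h
      have := h (uu W) (by simp [support_monomial])
      have h0 := wt_uu W 1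
      rw [one_smul] at h0
      omega

lemma mem_localizationComap {R : Type} [CommRing R] (p : Ideal R) (hp : p.IsPrime) (J : Ideal R)
    (f : R) : f ∈ localizationComap p hp J ↔ ∃ u ∉ p, u * f ∈ J := by
  let := hp
  unfold localizationComap
  rw [Ideal.mem_comap, IsLocalization.algebraMap_mem_map_algebraMap_iff p.primeCompl]
  rfl

lemma mem_symbolicPower (s : ℕ) (f : MvPolynomial V 𝕜) :
    f ∈ symbolicPower (edgeIdeal 𝕜 G) s ↔ ∀ m ∈ f.support, AA G s m := by
  classical
  constructor
  · intro hf m hm W hW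
    obtain ⟨W', hsub, hW'⟩ := exists_minCov W hW
    have h1 : f ∈ localizationComap (PW 𝕜 W') (PW_prime W') (edgeIdeal 𝕜 G ^ s) :=
      (Submodule.mem_sInf.mp hf) _ ⟨_, PW_prime W', PW_assoc hW', rfl⟩
    rw [mem_localizationComap] at h1
    obtain ⟨u, hu, huf⟩ := h1
    have h2 : Polynomial.X ^ s ∣ phi 𝕜 W' (u * f) := by
      rw [X_pow_dvd_phi]
      exact fun m hm => BB_AA ((mem_edgeIdeal_pow s _).mp huf m hm) W' hW'.1
    rw [map_mul] at h2
    rw [mem_PW_dvd] at hu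
    have h3 := Polynomial.prime_X.pow_dvd_of_dvd_mul_left s hu h2
    rw [X_pow_dvd_phi] at h3
    exact (h3 m hm).trans (Finset.sum_le_sum_of_subset hsub)
  · intro hf
    refine Submodule.mem_sInf.mpr ?_
    rintro _ ⟨p, hp, hass, rfl⟩
    obtain ⟨_, g, hg⟩ := Submodule.isAssociatedPrime_iff.mp hass
    obtain ⟨g, rfl⟩ := Ideal.Quotient.mk_surjective g
    have hmem : ∀ f, f ∈ p ↔ f * g ∈ edgeIdeal 𝕜 G := by
      intro f
      rw [hg, Submodule.mem_colon_singleton, Submodule.mem_bot,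
        show f • (Ideal.Quotient.mk (edgeIdeal 𝕜 G) g) =
          Ideal.Quotient.mk (edgeIdeal 𝕜 G) (f * g) from rfl,
        Ideal.Quotient.eq_zero_iff_mem]
    have hgI : g ∉ edgeIdeal 𝕜 G := by
      intro h
      exact hp.ne_top ((Ideal.eq_top_iff_one _).mpr ((hmem 1).mpr (by rwa [one_mul])))
    rw [← pow_one (edgeIdeal 𝕜 G), mem_edgeIdeal_pow] at hgI
    push Not at hgI
    obtain ⟨m0, hm0, hB⟩ := hgI
    have hcov : IsCov G (m0.supportᶜ) := by
      intro u v huv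
      by_contra h
      simp only [Finset.mem_compl, Finsupp.mem_support_iff, not_or, not_not] at h
      exact hB (BB_mono (ee_le_of huv.ne h.1 h.2) (BB_edge huv))
    obtain ⟨W, hsub, hW⟩ := exists_minCov _ hcov
    have hgW : g ∉ PW 𝕜 W := by
      rw [mem_PW]
      intro h
      have h1 := h m0 hm0
      have h2 : wt W m0 = 0 := Finset.sum_eq_zero fun v hv => by
        simpa using hsub hv
      omega
    have hpW : p ≤ PW 𝕜 W := by
      intro q hq
      have h1 := (hmem q).mp hq
      have h2 : q * g ∈ PW 𝕜 W := by
        rw [mem_PW]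
        rw [← pow_one (edgeIdeal 𝕜 G), mem_edgeIdeal_pow] at h1
        exact fun m hm => BB_AA (h1 m hm) W hW.1
      exact ((PW_prime W).mem_or_mem h2).resolve_right hgW
    rw [mem_localizationComap]
    refine ⟨monomial (s • uu W) 1, ?_, ?_⟩
    · intro h
      have := (mem_PW W _).mp (hpW h) (s • uu W) (by simp [support_monomial])
      rw [wt_uu] at this
      omega
    · rw [f.as_sum, Finset.mul_sum]
      refine Ideal.sum_mem _ fun m hm => ?_
      have h2 := (monomial_mem_pow (𝕜 := 𝕜) s _).mpr (BB_uu hW s m (hf m hm W hW.1))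
      have h3 := Ideal.mul_mem_left _ (C (coeff m f)) h2
      rw [C_mul_monomial, mul_one] at h3
      rwa [monomial_mul, one_mul, add_comm]

end alg

section fin
variable {V : Type} [Fintype V] {𝕜 : Type} [Field 𝕜] {G : SimpleGraph V}

/-- minimal exponents of the symbolic power outside of the ordinary power -/
def DD (G : SimpleGraph V) (s : ℕ) : Set (V →₀ ℕ) := {m | Minimal (AA G s) m ∧ ¬ BB G s m}

lemma minAA_finite (s : ℕ) : {m : V →₀ ℕ | Minimal (AA G s) m}.Finite :=
  (setOfPred_minimal_antichain _).finite_of_partiallyWellOrderedOn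
    (Set.isPWO_of_wellQuasiOrderedLE _)

lemma exists_min (P : (V →₀ ℕ) → Prop) (m : V →₀ ℕ) (h : P m) : ∃ g ≤ m, Minimal P g := by
  obtain ⟨g, h1, h2⟩ := (Set.isPWO_of_wellQuasiOrderedLE {m | P m}).exists_le_minimal h
  exact ⟨g, h1, h2⟩

lemma DD_finite (s : ℕ) : (DD G s).Finite := (minAA_finite s).subset fun _ h => h.1

lemma pow_le_symb (s : ℕ) : (edgeIdeal 𝕜 G) ^ s ≤ symbolicPower (edgeIdeal 𝕜 G) s := by
  intro f hf
  rw [mem_edgeIdeal_pow] at hf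
  rw [mem_symbolicPower]
  exact fun m hm => BB_AA (hf m hm)

lemma monomial_mem_symb (s : ℕ) (m : V →₀ ℕ) :
    monomial m (1 : 𝕜) ∈ symbolicPower (edgeIdeal 𝕜 G) s ↔ AA G s m := by
  classical
  rw [mem_symbolicPower, support_monomial]
  simp

lemma coeff_min {s : ℕ} {d : V →₀ ℕ} (hd : Minimal (AA G s) d) (r f : MvPolynomial V 𝕜)
    (hf : f ∈ symbolicPower (edgeIdeal 𝕜 G) s) : coeff d (r * f) = coeff 0 r * coeff d f := by
  classical
  rw [coeff_mul, Finset.sum_eq_single (0, d)]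
  · rintro ⟨a, b⟩ hab hne
    rw [Finset.HasAntidiagonal.mem_antidiagonal] at hab
    by_contra h
    have hb : b ∈ f.support := mem_support_iff.mpr (right_ne_zero_of_mul h)
    have h1 := (mem_symbolicPower s f).mp hf b hb
    have h2 : b = d := hd.eq_of_le h1 (hab ▸ le_add_self)
    simp only at hab
    subst h2
    have : a = 0 := by simpa using hab
    exact hne (by rw [this])
  · intro h
    exact absurd (Finset.HasAntidiagonal.mem_antidiagonal.mpr (zero_add d)) h

theorem sdefect_eq (s : ℕ) : sdefect (edgeIdeal 𝕜 G) s = (DD G s).ncard := by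
  classical
  have hfin := DD_finite (G := G) s
  apply le_antisymm
  · apply Nat.sInf_le
    refine ⟨hfin.toFinset.image (fun m => monomial m (1 : 𝕜)), ?_, ?_, ?_⟩
    · rw [Finset.card_image_of_injective _ (monomial_left_injective one_ne_zero),
        Set.ncard_eq_toFinset_card _ hfin]
    · intro f hf
      simp only [Finset.coe_image, Set.Finite.coe_toFinset] at hf
      obtain ⟨m, hm, rfl⟩ := hf
      exact (monomial_mem_symb s m).mpr hm.1.prop
    · apply le_antisymm
      · refine sup_le (pow_le_symb s) (Ideal.span_le.mpr ?_)
        intro f hf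
        simp only [Finset.coe_image, Set.Finite.coe_toFinset] at hf
        obtain ⟨m, hm, rfl⟩ := hf
        exact (monomial_mem_symb s m).mpr hm.1.prop
      · intro f hf
        rw [mem_symbolicPower] at hf
        rw [f.as_sum]
        refine Ideal.sum_mem _ fun m hm => ?_
        obtain ⟨g, hgm, hg⟩ := exists_min _ m (hf m hm)
        have hmem : monomial g (1 : 𝕜) ∈ edgeIdeal 𝕜 G ^ s ⊔ Ideal.span
            (↑(hfin.toFinset.image (fun m => monomial m (1 : 𝕜))) : Set (MvPolynomial V 𝕜)) := by
          by_cases hB : BB G s g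
          · exact Ideal.mem_sup_left ((monomial_mem_pow s g).mpr hB)
          · refine Ideal.mem_sup_right (Ideal.subset_span ?_)
            simp only [Finset.coe_image, Set.Finite.coe_toFinset]
            exact ⟨g, ⟨hg, hB⟩, rfl⟩
        refine Ideal.mem_of_dvd _ ?_ hmem
        rw [monomial_dvd_monomial]
        exact ⟨Or.inr hgm, one_dvd _⟩
  · have hne : {m : ℕ | ∃ S : Finset (MvPolynomial V 𝕜), S.card = m ∧
        (↑S : Set (MvPolynomial V 𝕜)) ⊆ (symbolicPower (edgeIdeal 𝕜 G) s : Set _) ∧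
        (edgeIdeal 𝕜 G) ^ s ⊔ Ideal.span (↑S : Set _) = symbolicPower (edgeIdeal 𝕜 G) s}.Nonempty := by
      obtain ⟨S, hS⟩ := (isNoetherianRing_iff_ideal_fg _).mp inferInstance
        (symbolicPower (edgeIdeal 𝕜 G) s)
      refine ⟨S.card, S, rfl, ?_, ?_⟩
      · rw [← hS]; exact Ideal.subset_span
      · rw [hS]; exact sup_eq_right.mpr (pow_le_symb s)
    refine le_csInf hne ?_
    rintro _ ⟨S, rfl, hS1, hS2⟩
    let := hfin.fintype
    let π : MvPolynomial V 𝕜 →ₗ[𝕜] (DD G s → 𝕜) := LinearMap.pi fun d => lcoeff 𝕜 d.1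
    have hπ : ∀ f d, π f d = coeff d.1 f := fun _ _ => rfl
    have hpow : ∀ f ∈ edgeIdeal 𝕜 G ^ s, π f = 0 := by
      intro f hf
      ext d
      rw [hπ]
      by_contra h
      exact d.2.2 ((mem_edgeIdeal_pow s f).mp hf _ (mem_support_iff.mpr h))
    have hspan : ∀ f ∈ Ideal.span (↑S : Set (MvPolynomial V 𝕜)),
        f ∈ symbolicPower (edgeIdeal 𝕜 G) s ∧ π f ∈ Submodule.span 𝕜 (S.image π : Set _) := by
      intro f hf
      induction hf using Submodule.span_induction with
      | mem f hf =>
        exact ⟨hS1 hf, Submodule.subset_span (Finset.mem_coe.mpr (Finset.mem_image_of_mem _ hf))⟩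
      | zero => exact ⟨zero_mem _, by rw [map_zero]; exact zero_mem _⟩
      | add f g _ _ h1 h2 =>
        exact ⟨add_mem h1.1 h2.1, by rw [map_add]; exact add_mem h1.2 h2.2⟩
      | smul r f _ h1 =>
        refine ⟨Ideal.mul_mem_left _ r h1.1, ?_⟩
        have : π (r • f) = coeff 0 r • π f := by
          ext d
          rw [Pi.smul_apply, hπ, hπ, smul_eq_mul, smul_eq_mul]
          exact coeff_min d.2.1 r f h1.1
        rw [this]
        exact Submodule.smul_mem _ _ h1.2
    have htop : Submodule.span 𝕜 (S.image π : Set (DD G s → 𝕜)) = ⊤ := by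
      rw [eq_top_iff, ← (Pi.basisFun 𝕜 (DD G s)).span_eq, Submodule.span_le]
      rintro _ ⟨d, rfl⟩
      have h1 := (monomial_mem_symb (𝕜 := 𝕜) s d.1).mpr d.2.1.prop
      rw [← hS2] at h1
      obtain ⟨a, ha, b, hb, hab⟩ := Submodule.mem_sup.mp h1
      have h2 : π (monomial d.1 1) = Pi.basisFun 𝕜 (DD G s) d := by
        ext d'
        rw [hπ, coeff_monomial, Pi.basisFun_apply, Pi.single_apply]
        simp only [Subtype.ext_iff, eq_comm]
      rw [← h2, ← hab, map_add, hpow a ha, zero_add]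
      exact (hspan b hb).2
    have h1 := finrank_span_finset_le_card (R := 𝕜) (S.image π)
    rw [Set.finrank, htop, finrank_top, Module.finrank_fintype_fun_eq_card] at h1
    have h2 : (S.image π).card ≤ S.card := Finset.card_image_le
    rw [← Nat.card_coe_set_eq, Nat.card_eq_fintype_card]
    exact h1.trans h2

lemma isMinMonomialGen_iff (J : Ideal (MvPolynomial V 𝕜)) (P : (V →₀ ℕ) → Prop)
    (hJ : ∀ m, monomial m (1 : 𝕜) ∈ J ↔ P m) (f : MvPolynomial V 𝕜) :
    IsMinMonomialGen J f ↔ ∃ m, f = monomial m 1 ∧ Minimal P m := by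
  constructor
  · rintro ⟨⟨m, rfl⟩, h1, h2⟩
    refine ⟨m, rfl, (hJ m).mp h1, fun m' hm' hle => ?_⟩
    have := h2 (monomial m' 1) ⟨m', rfl⟩ ((hJ m').mpr hm')
      (monomial_dvd_monomial.mpr ⟨Or.inr hle, one_dvd _⟩)
    exact (monomial_left_injective one_ne_zero this).ge
  · rintro ⟨m, rfl, h1, h2⟩
    refine ⟨⟨m, rfl⟩, (hJ m).mpr h1, ?_⟩
    rintro _ ⟨m', rfl⟩ hm' hdvd
    have hle : m' ≤ m := (monomial_dvd_monomial.mp hdvd).1.resolve_left one_ne_zero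
    rw [le_antisymm hle (h2 ((hJ m').mp hm') hle)]

lemma monomial_mem_mul (k : ℕ) (c0 m : V →₀ ℕ) :
    monomial m (1 : 𝕜) ∈ (edgeIdeal 𝕜 G) ^ k * Ideal.span {monomial c0 1} ↔
      ∃ m', m = m' + c0 ∧ BB G k m' := by
  classical
  rw [Ideal.mem_mul_span_singleton]
  constructor
  · rintro ⟨z, hz, h⟩
    have h1 := congrArg (coeff m) h
    rw [coeff_mul_monomial', coeff_monomial, if_pos rfl] at h1
    split_ifs at h1 with hle
    · refine ⟨m - c0, (tsub_add_cancel_of_le hle).symm, ?_⟩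
      refine (mem_edgeIdeal_pow k z).mp hz _ (mem_support_iff.mpr ?_)
      intro h0
      rw [h0, zero_mul] at h1
      exact zero_ne_one h1
    · exact absurd h1 zero_ne_one
  · rintro ⟨m', rfl, h⟩
    exact ⟨monomial m' 1, (monomial_mem_pow k m').mpr h, by rw [monomial_mul, one_mul]⟩

variable {n : ℕ} {x : ZMod (2 * n + 1) → V}

lemma minAA_deg (hn : 1 ≤ n) (hx : IsUnicyclicOddCycle G n x) {t : ℕ} {g : V →₀ ℕ}
    (hg : Minimal (AA G t) g) : wt Finset.univ g ≤ 2 * t := by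
  obtain ⟨g', h1, h2, h3⟩ := T2 hn hx t g hg.prop
  rwa [hg.eq_of_le h2 h1] at h3

lemma DD_eq (hn : 1 ≤ n) (hx : IsUnicyclicOddCycle G n x) (t : ℕ) :
    DD G (t + (n + 1)) = (fun g => g + cc x) '' {g | Minimal (AA G t) g} := by
  ext h
  constructor
  · rintro ⟨hmin, hB⟩
    rcases T1 hn hx _ h hmin.prop with h1 | ⟨m', s', rfl, hs', h'⟩
    · exact absurd h1 hB
    · have : s' = t := by omega
      subst this
      refine ⟨m', ⟨h', fun g hg hle => ?_⟩, rfl⟩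
      have := hmin.eq_of_le (AA_add hg (AA_cc hx)) (add_le_add_left hle _)
      exact (add_right_cancel this).ge
  · rintro ⟨g, hg, rfl⟩
    have hdeg := minAA_deg hn hx hg
    have hnB : ∀ k ≤ g + cc x, ¬ BB G (t + (n + 1)) k := by
      intro k hk hB
      have h1 := BB_deg hB
      have h2 := wt_mono (W := Finset.univ) hk
      rw [wt_add, wt_univ_cc] at h2
      omega
    refine ⟨⟨AA_add hg.prop (AA_cc hx), fun k hk hle => ?_⟩, hnB _ le_rfl⟩
    rcases T1 hn hx _ k hk with h1 | ⟨m', s', rfl, hs', h'⟩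
    · exact absurd h1 (hnB k hle)
    · have : s' = t := by omega
      subst this
      have hle' : m' ≤ g := le_of_add_le_add_right hle
      exact add_le_add_left (hg.2 h' hle') _

/-- the minimal exponents of the ordinary power which stay minimal -/
lemma GG_eq (hn : 1 ≤ n) (hx : IsUnicyclicOddCycle G n x) (k : ℕ) (f : V →₀ ℕ) :
    (Minimal (BB G (k + (n + 1))) f ∧
      ¬ ∃ g, Minimal (fun m => ∃ m', m = m' + cc x ∧ BB G k m') g ∧ g ≤ f) ↔
    Minimal (AA G (k + (n + 1))) f ∧ BB G (k + (n + 1)) f := by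
  classical
  constructor
  · rintro ⟨hmin, hno⟩
    have hdeg : wt Finset.univ f = 2 * (k + (n + 1)) := by
      obtain ⟨m1, r, rfl, h1, h2⟩ := BB_exact hmin.prop
      rw [hmin.eq_of_le h1 le_self_add] at h2
      exact h2
    have hno' : ∀ m', BB G k m' → ¬ m' + cc x ≤ f := by
      intro m' hm' hle
      obtain ⟨g, hg1, hg2⟩ := exists_min (fun m => ∃ m', m = m' + cc x ∧ BB G k m')
        (m' + cc x) ⟨m', rfl, hm'⟩
      exact hno ⟨g, hg2, hg1.trans hle⟩
    refine ⟨⟨BB_AA hmin.prop, fun g hg hle => ?_⟩, hmin.prop⟩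
    rcases T1 hn hx _ g hg with h1 | ⟨m', s', rfl, hs', h'⟩
    · exact hmin.2 h1 hle
    · exfalso
      have : s' = k := by omega
      subst this
      obtain ⟨r, rfl⟩ := exists_add_of_le hle
      refine hno' (m' + r) ?_ (by rw [add_right_comm])
      refine T3 hn hx s' (m' + r) (AA_mono le_self_add h') ?_ ?_
      · rw [wt_add, wt_add, wt_univ_cc] at hdeg
        rw [wt_add]; omega
      · have h9 := hmin.prop
        rw [add_right_comm m' (cc x) r] at h9
        exact h9
  · rintro ⟨hmin, hB⟩
    refine ⟨⟨hB, fun g hg hle => hmin.2 (BB_AA hg) hle⟩, ?_⟩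
    rintro ⟨g, ⟨⟨m', rfl, hm'⟩, -⟩, hle⟩
    obtain ⟨m1, r, rfl, h1, h2⟩ := BB_exact hm'
    have hle' : m1 + cc x ≤ f := le_trans (add_le_add_left le_self_add _) hle
    have h3 := hmin.eq_of_le (AA_add (BB_AA h1) (AA_cc hx)) hle'
    have h4 := BB_deg hB
    rw [← h3, wt_add, wt_univ_cc] at h4
    omega

end fin

/-- the symbolic-defect recursion for the edge ideal `I` of a unicyclic graph
with unique odd cycle `C_{2n+1}`: for `s ≥ 2n+2`,
`sdefect(I,s) = |𝒢_{s-(n+1)}| + sdefect(I, s-(n+1))`, where `𝒢_{s-(n+1)}` is the set of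
minimal monomial generators of `I^{s-(n+1)}` that are not multiples of any minimal monomial
generator of `I^{s-2(n+1)}·(c)`. -/
theorem unicyclic_sdefect_recursion {V : Type} [Fintype V] (𝕜 : Type) [Field 𝕜]
    (G : SimpleGraph V) (n : ℕ) (hn : 1 ≤ n)
    (x : ZMod (2 * n + 1) → V) (hx : IsUnicyclicOddCycle G n x)
    (c : MvPolynomial V 𝕜) (hc : c = ∏ j : ZMod (2 * n + 1), X (x j))
    (s : ℕ) (hs : 2 * n + 2 ≤ s) :
    sdefect (edgeIdeal 𝕜 G) s =
      {f : MvPolynomial V 𝕜 |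
        IsMinMonomialGen ((edgeIdeal 𝕜 G) ^ (s - (n + 1))) f ∧
        ¬ ∃ g : MvPolynomial V 𝕜,
          IsMinMonomialGen ((edgeIdeal 𝕜 G) ^ (s - 2 * (n + 1)) * Ideal.span {c}) g ∧
            g ∣ f}.ncard +
      sdefect (edgeIdeal 𝕜 G) (s - (n + 1)) := by
  classical
  have hc' : c = monomial (cc x) 1 := by
    rw [hc, cc, monomial_sum_one]
    rfl
  obtain ⟨k, rfl⟩ := Nat.exists_eq_add_of_le hs
  rw [show 2 * n + 2 + k - 2 * (n + 1) = k by omega,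
    show 2 * n + 2 + k - (n + 1) = k + (n + 1) by omega,
    show 2 * n + 2 + k = k + (n + 1) + (n + 1) by omega, sdefect_eq, sdefect_eq, DD_eq hn hx,
    Set.ncard_image_of_injective _ (add_left_injective _)]
  have hset : {f : MvPolynomial V 𝕜 |
        IsMinMonomialGen ((edgeIdeal 𝕜 G) ^ (k + (n + 1))) f ∧
        ¬ ∃ g : MvPolynomial V 𝕜,
          IsMinMonomialGen ((edgeIdeal 𝕜 G) ^ k * Ideal.span {c}) g ∧ g ∣ f} =
      (fun m => monomial m (1 : 𝕜)) ''
        {m | Minimal (AA G (k + (n + 1))) m ∧ BB G (k + (n + 1)) m} := by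
    ext f
    simp only [Set.mem_setOf_eq, Set.mem_image]
    simp_rw [isMinMonomialGen_iff _ _ (monomial_mem_pow (𝕜 := 𝕜) (G := G) (k + (n + 1))), hc',
      isMinMonomialGen_iff _ _ (monomial_mem_mul (𝕜 := 𝕜) (G := G) k (cc x)), ← GG_eq hn hx]
    constructor
    · rintro ⟨⟨m, rfl, hm⟩, hno⟩
      refine ⟨m, ⟨hm, ?_⟩, rfl⟩
      rintro ⟨g, hg, hle⟩
      exact hno ⟨monomial g 1, ⟨g, rfl, hg⟩, monomial_dvd_monomial.mpr ⟨Or.inr hle, one_dvd _⟩⟩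
    · rintro ⟨m, ⟨hm, hno⟩, rfl⟩
      refine ⟨⟨m, rfl, hm⟩, ?_⟩
      rintro ⟨_, ⟨g, rfl, hg⟩, hdvd⟩
      exact hno ⟨g, hg, (monomial_dvd_monomial.mp hdvd).1.resolve_left one_ne_zero⟩
  rw [hset, Set.ncard_image_of_injective _ (monomial_left_injective one_ne_zero)]
  have hfin := minAA_finite (G := G) (k + (n + 1))
  rw [← Set.ncard_union_eq ?_ (hfin.subset fun _ h => h.1) (DD_finite _)]
  · congr 1
    ext m
    simp only [DD, Set.mem_union, Set.mem_setOf_eq]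
    tauto
  · rw [Set.disjoint_left]
    intro m h1 h2
    exact h2.2 h1.2

end
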